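/- Grant the compatibility condition ζ ≤ √(2⌊K/2⌋)/(4K). There exist constants c=c(K)>0 and ε₀>0 such that whenever ε≤ε₀, δ≤1/6, L≤1/3 and n·δ²·ε⁴·ζ⁴ ≥ 1: the infimum over all estimators φ̂₂ (measurable functions of (Y₁,…,Yₙ)) of sup over (φ,ψ)∈Φ_L(δ,ε,ζ) of P_{(φ,ψ)}( |φ̂₂−φ₂|² ≥ c/(n·δ²·ε²·ζ⁴) ) is at least 1/4; and likewise the infimum over estimators of sup over Φ_L of P_{(φ,ψ)}( |φ̂₂/φ₂ − 1|² ≥ c/(n·δ²·ε⁴·ζ⁴) ) is at least 1/4. -/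

import Mathlib

open scoped BigOperators

namespace PaperHMM

/-- Parameter of a two-state HMM with multinomial emissions on `Fin K`. -/
structure Param (K : ℕ) where
  p : ℝ
  q : ℝ
  f0 : Fin K → ℝ
  f1 : Fin K → ℝ

/-- `f` is a probability density with respect to counting measure on `Fin K`. -/
def IsDensity {K : ℕ} (f : Fin K → ℝ) : Prop :=
  (∀ k, 0 ≤ f k) ∧ ∑ k, f k = 1

/-- Validity of HMM parameters: `p, q ∈ (0,1)` and emission densities. -/
def Valid {K : ℕ} (θ : Param K) : Prop :=
  θ.p ∈ Set.Ioo (0 : ℝ) 1 ∧ θ.q ∈ Set.Ioo (0 : ℝ) 1 ∧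
    IsDensity θ.f0 ∧ IsDensity θ.f1

/-- Euclidean norm of a finitely supported real function. -/
noncomputable def enormF {α : Type*} [Fintype α] (g : α → ℝ) : ℝ :=
  Real.sqrt (∑ a, (g a) ^ 2)

/-- Stationary initial distribution of the hidden chain: `P(X₁=0)=q/(p+q)`. -/
noncomputable def initD {K : ℕ} (θ : Param K) : Fin 2 → ℝ :=
  fun a => if a = 0 then θ.q / (θ.p + θ.q) else θ.p / (θ.p + θ.q)

/-- Transition matrix `Q = [[1-p, p], [q, 1-q]]` of the hidden chain. -/
noncomputable def transP {K : ℕ} (θ : Param K) : Fin 2 → Fin 2 → ℝ :=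
  fun a b =>
    if a = 0 then (if b = 0 then 1 - θ.p else θ.p)
    else (if b = 0 then θ.q else 1 - θ.q)

/-- Emission densities indexed by the hidden state. -/
def emit {K : ℕ} (θ : Param K) : Fin 2 → Fin K → ℝ :=
  fun a => if a = 0 then θ.f0 else θ.f1

/-- The probability mass function `p_θ^{(n)}` of the first `n` observations
`(Y₁,…,Yₙ)`:  `∑_{x ∈ {0,1}ⁿ} P(X₁=x₁) ∏_{i<n} Q_{x_i,x_{i+1}} ∏_{i≤n} f_{x_i}(y_i)`. -/
noncomputable def pLaw {K : ℕ} (θ : Param K) (n : ℕ) (y : Fin n → Fin K) : ℝ :=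
  ∑ x : Fin n → Fin 2,
    (∏ i : Fin n,
        (if (i : ℕ) = 0 then initD θ (x i)
          else transP θ (x ⟨(i : ℕ) - 1, lt_of_le_of_lt (Nat.sub_le _ _) i.isLt⟩) (x i)))
      * ∏ i : Fin n, emit θ (x i) (y i)

open Classical in
/-- Probability under `P_θ` that `(Y₁,…,Yₙ)` lies in the event `E`. -/
noncomputable def probOf {K : ℕ} (θ : Param K) (n : ℕ)
    (E : (Fin n → Fin K) → Prop) : ℝ :=
  ∑ y : Fin n → Fin K, if E y then pLaw θ n y else 0

/-- The parameter class `Θ(δ,ε,ζ)`. -/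
def ThetaSet (K : ℕ) (δ ε ζ : ℝ) : Set (Param K) :=
  {θ | Valid θ ∧ δ ≤ θ.p ∧ δ ≤ θ.q ∧ ε ≤ |1 - θ.p - θ.q| ∧
    ζ ≤ enormF (fun k => θ.f0 k - θ.f1 k)}

/-- The parameter class `Θ_L(δ,ε,ζ)`. -/
def ThetaL (K : ℕ) (L δ ε ζ : ℝ) : Set (Param K) :=
  ThetaSet K δ ε ζ ∩ {θ | L ≤ 1 - |1 - θ.p - θ.q|}

/-- The reparametrised pair `(φ, ψ)`: scalar parameters `φ = (φ₁,φ₂,φ₃)` and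
vector parameters `ψ = (ψ₁, ψ₂)`. -/
abbrev PP (K : ℕ) := (ℝ × ℝ × ℝ) × ((Fin K → ℝ) × (Fin K → ℝ))

/-- `φ(θ) = ((q-p)/(p+q), 1-p-q, ‖f₀-f₁‖)`. -/
noncomputable def phiOf {K : ℕ} (θ : Param K) : ℝ × ℝ × ℝ :=
  ((θ.q - θ.p) / (θ.p + θ.q), 1 - θ.p - θ.q,
    enormF (fun k => θ.f0 k - θ.f1 k))

/-- `ψ(θ) = ((q f₀ + p f₁)/(p+q), (f₀-f₁)/‖f₀-f₁‖)`. -/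
noncomputable def psiOf {K : ℕ} (θ : Param K) : (Fin K → ℝ) × (Fin K → ℝ) :=
  (fun k => (θ.q * θ.f0 k + θ.p * θ.f1 k) / (θ.p + θ.q),
    fun k => (θ.f0 k - θ.f1 k) / enormF (fun j => θ.f0 j - θ.f1 j))

/-- The map `θ ↦ (φ(θ), ψ(θ))`. -/
noncomputable def pack {K : ℕ} (θ : Param K) : PP K := (phiOf θ, psiOf θ)

/-- The inverse parametrisation `θ(φ,ψ)`:
`p = ½(1-φ₂)(1-φ₁)`, `q = ½(1-φ₂)(1+φ₁)`,
`f₀ = ψ₁ - ½φ₁φ₃ψ₂ + ½φ₃ψ₂`, `f₁ = ψ₁ - ½φ₁φ₃ψ₂ - ½φ₃ψ₂`. -/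
noncomputable def unpack {K : ℕ} (π : PP K) : Param K where
  p := (1 - π.1.2.1) * (1 - π.1.1) / 2
  q := (1 - π.1.2.1) * (1 + π.1.1) / 2
  f0 := fun k => π.2.1 k - π.1.1 * π.1.2.2 * π.2.2 k / 2 + π.1.2.2 * π.2.2 k / 2
  f1 := fun k => π.2.1 k - π.1.1 * π.1.2.2 * π.2.2 k / 2 - π.1.2.2 * π.2.2 k / 2

/-- `Φ(δ,ε,ζ)`. -/
def PhiSet (K : ℕ) (δ ε ζ : ℝ) : Set (PP K) := pack '' ThetaSet K δ ε ζ

/-- `Φ_L(δ,ε,ζ)`. -/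
def PhiL (K : ℕ) (L δ ε ζ : ℝ) : Set (PP K) := pack '' ThetaL K L δ ε ζ

/-- `⋃_{δ,ε,ζ} Φ(δ,ε,ζ)`. -/
def PhiAll (K : ℕ) : Set (PP K) :=
  ⋃ (δ ∈ Set.Ioo (0 : ℝ) 1) (ε ∈ Set.Ioo (0 : ℝ) 1) (ζ ∈ Set.Ioi (0 : ℝ)),
    PhiSet K δ ε ζ

/-- `r(φ) = ¼ (1-φ₁²) φ₂ φ₃²`. -/
noncomputable def rfun (φ : ℝ × ℝ × ℝ) : ℝ :=
  (1 - φ.1 ^ 2) * φ.2.1 * φ.2.2 ^ 2 / 4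

/-- `m(φ) = (r(φ), φ₂ r(φ), φ₁ φ₂ φ₃ r(φ))`. -/
noncomputable def mvec (φ : ℝ × ℝ × ℝ) : ℝ × ℝ × ℝ :=
  (rfun φ, φ.2.1 * rfun φ, φ.1 * φ.2.1 * φ.2.2 * rfun φ)

/-- Sign function with the convention `sgn 0 = +1`. -/
noncomputable def sgn (t : ℝ) : ℝ := if t < 0 then -1 else 1

/-- The statistical distance `ρ((φ,ψ);(φ̃,ψ̃))`. -/
noncomputable def rho {K : ℕ} (π π' : PP K) : ℝ :=
  max (max (max (max
    |(mvec π.1).1 - (mvec π'.1).1|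
    |(mvec π.1).2.1 - (mvec π'.1).2.1|)
    |(mvec π.1).2.2 - sgn (∑ k, π.2.2 k * π'.2.2 k) * (mvec π'.1).2.2|)
    (enormF fun k => π.2.1 k - π'.2.1 k))
    ((max |(mvec π.1).1| |(mvec π'.1).1|) *
      enormF fun k => π.2.2 k - sgn (∑ j, π.2.2 j * π'.2.2 j) * π'.2.2 k)

/-- `p^{(3)}_{φ,ψ} = p^{(3)}_{θ(φ,ψ)}`, the law of three consecutive observations. -/
noncomputable def p3 {K : ℕ} (π : PP K) : (Fin 3 → Fin K) → ℝ :=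
  pLaw (unpack π) 3

/-- The empirical estimator `p̂ₙ^{(3)}(a,b,c) = n⁻¹ ∑_{i=1}^{n-2} 1{Yᵢ=a, Y_{i+1}=b, Y_{i+2}=c}`. -/
noncomputable def empP3 {K : ℕ} (n : ℕ) (y : Fin n → Fin K)
    (v : Fin 3 → Fin K) : ℝ :=
  (n : ℝ)⁻¹ * ∑ i : Fin n,
    if h : (i : ℕ) + 2 < n then
      (if y i = v 0 ∧ y ⟨(i : ℕ) + 1, by omega⟩ = v 1 ∧ y ⟨(i : ℕ) + 2, h⟩ = v 2
        then 1 else 0)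
    else 0

/-- Kullback–Leibler divergence `K(P;Q) = ∑_y P(y) log(P(y)/Q(y))` between
probability mass functions on `(Fin K)ⁿ`. -/
noncomputable def klDiv {K : ℕ} (n : ℕ) (P Q : (Fin n → Fin K) → ℝ) : ℝ :=
  ∑ y : Fin n → Fin K, P y * Real.log (P y / Q y)


lemma sum_snoc {α : Type*} [Fintype α] {n : ℕ} (F : (Fin (n+1) → α) → ℝ) :
    ∑ x, F x = ∑ x : Fin n → α, ∑ a, F (Fin.snoc (α := fun _ => α) x a) := by
  rw [← (Fin.snocEquiv (fun _ : Fin (n+1) => α)).sum_comp, Fintype.sum_prod_type,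
    Finset.sum_comm]
  rfl

/-- Joint mass of the first `n` observations and the next hidden state. -/
noncomputable def HH {K : ℕ} (θ : Param K) (n : ℕ) (y : Fin n → Fin K) (b : Fin 2) : ℝ :=
  ∑ x : Fin n → Fin 2,
    (∏ i : Fin (n+1),
        (if (i : ℕ) = 0 then initD θ (Fin.snoc (α := fun _ => Fin 2) x b i)
          else transP θ (Fin.snoc (α := fun _ => Fin 2) x b
            ⟨(i : ℕ) - 1, lt_of_le_of_lt (Nat.sub_le _ _) i.isLt⟩)
            (Fin.snoc (α := fun _ => Fin 2) x b i)))
      * ∏ i : Fin n, emit θ (x i) (y i)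

lemma HH_zero {K : ℕ} (θ : Param K) (y : Fin 0 → Fin K) (b : Fin 2) :
    HH θ 0 y b = initD θ b := by
  simp [HH, Fin.snoc]

lemma pLaw_zero {K : ℕ} (θ : Param K) (y : Fin 0 → Fin K) : pLaw θ 0 y = 1 := by
  simp [pLaw]

lemma pLaw_snoc {K : ℕ} (θ : Param K) (n : ℕ) (y : Fin n → Fin K) (k : Fin K) :
    pLaw θ (n+1) (Fin.snoc (α := fun _ => Fin K) y k) = ∑ b, HH θ n y b * emit θ b k := by
  unfold pLaw HH
  rw [sum_snoc, Finset.sum_comm]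
  refine Finset.sum_congr rfl fun b _ => ?_
  rw [Finset.sum_mul]
  refine Finset.sum_congr rfl fun x _ => ?_
  rw [Fin.prod_univ_castSucc (fun i : Fin (n+1) => emit θ _ _)]
  simp only [Fin.snoc_castSucc, Fin.snoc_last]
  ring

lemma snoc_pred {n : ℕ} {α : Type*} (x : Fin n → α) (b : α) (i : Fin n) (h) :
    (Fin.snoc (α := fun _ => α) x b ⟨(i : ℕ) - 1, h⟩ : α)
      = x ⟨(i : ℕ) - 1, lt_of_le_of_lt (Nat.sub_le _ _) i.isLt⟩ := by
  have : (⟨(i : ℕ) - 1, h⟩ : Fin (n+1)) =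
    Fin.castSucc ⟨(i : ℕ) - 1, lt_of_le_of_lt (Nat.sub_le _ _) i.isLt⟩ := rfl
  rw [this, Fin.snoc_castSucc]

lemma HH_snoc {K : ℕ} (θ : Param K) (n : ℕ) (y : Fin n → Fin K) (k : Fin K) (b : Fin 2) :
    HH θ (n+1) (Fin.snoc (α := fun _ => Fin K) y k) b
      = ∑ a, HH θ n y a * emit θ a k * transP θ a b := by
  unfold HH
  rw [sum_snoc, Finset.sum_comm]
  refine Finset.sum_congr rfl fun a _ => ?_
  rw [Finset.sum_mul, Finset.sum_mul]
  refine Finset.sum_congr rfl fun x _ => ?_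
  rw [Fin.prod_univ_castSucc (fun i : Fin (n+1) => emit θ _ _),
    Fin.prod_univ_castSucc (n := n+1)]
  simp only [Fin.snoc_castSucc, Fin.snoc_last, Fin.val_castSucc, snoc_pred]
  have h2 : (Fin.snoc (α := fun _ => Fin 2) (Fin.snoc (α := fun _ => Fin 2) x a : Fin (n+1) → Fin 2) b
      ⟨((Fin.last (n+1) : Fin (n+2)) : ℕ) - 1, lt_of_le_of_lt (Nat.sub_le _ _) (Fin.last (n+1)).isLt⟩ : Fin 2) = a := by
    have : (⟨((Fin.last (n+1) : Fin (n+2)) : ℕ) - 1, lt_of_le_of_lt (Nat.sub_le _ _) (Fin.last (n+1)).isLt⟩ : Fin (n+2))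
      = Fin.castSucc (Fin.last n) := rfl
    rw [this, Fin.snoc_castSucc, Fin.snoc_last]
  rw [h2]
  simp only [Fin.val_last, Nat.add_eq_zero_iff, one_ne_zero, and_false, if_false]
  ring

/-- The family of parameters used in the lower bound. -/
noncomputable def par {K : ℕ} (z : Fin K → ℝ) (u v w : ℝ) : Param K where
  p := (1 - v) * (1 - u) / 2
  q := (1 - v) * (1 + u) / 2
  f0 := fun k => 1 / K * (1 + (1 - u) * w * z k)
  f1 := fun k => 1 / K * (1 - (1 + u) * w * z k)

/-- The unnormalised filter mean. -/
noncomputable def DD {K : ℕ} (z : Fin K → ℝ) (u v w : ℝ) (n : ℕ) (y : Fin n → Fin K) : ℝ :=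
  w * ((1 - u) * HH (par z u v w) n y 0 - (1 + u) * HH (par z u v w) n y 1)

lemma pLaw_eq {K : ℕ} (z : Fin K → ℝ) (u v w : ℝ) (hv : v < 1) (n : ℕ) (y : Fin n → Fin K) :
    pLaw (par z u v w) n y = HH (par z u v w) n y 0 + HH (par z u v w) n y 1 := by
  have hv' : 1 - v ≠ 0 := by linarith
  cases n with
  | zero =>
    rw [pLaw_zero, HH_zero, HH_zero]
    simp only [initD, par]
    have : (1 - v) * (1 - u) / 2 + (1 - v) * (1 + u) / 2 = 1 - v := by ring
    simp [this]
    field_simp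
    ring
  | succ n =>
    rw [← Fin.snoc_init_self y, pLaw_snoc, HH_snoc, HH_snoc]
    simp [Fin.sum_univ_two, transP]
    ring

lemma pLaw_step {K : ℕ} (z : Fin K → ℝ) (u v w : ℝ) (hv : v < 1) (n : ℕ) (y : Fin n → Fin K)
    (k : Fin K) :
    pLaw (par z u v w) (n+1) (Fin.snoc (α := fun _ => Fin K) y k)
      = 1 / K * (pLaw (par z u v w) n y + z k * DD z u v w n y) := by
  rw [pLaw_snoc, pLaw_eq z u v w hv, DD]
  simp only [Fin.sum_univ_two, emit]
  simp [par]
  ring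

lemma DD_zero {K : ℕ} (z : Fin K → ℝ) (u v w : ℝ) (hv : v < 1) (y : Fin 0 → Fin K) :
    DD z u v w 0 y = 0 := by
  have hv' : 1 - v ≠ 0 := by linarith
  rw [DD, HH_zero, HH_zero]
  simp only [initD, par]
  have : (1 - v) * (1 - u) / 2 + (1 - v) * (1 + u) / 2 = 1 - v := by ring
  simp [this]
  right
  field_simp
  ring

lemma DD_step {K : ℕ} (z : Fin K → ℝ) (u v w : ℝ) (hv : v < 1) (n : ℕ) (y : Fin n → Fin K)
    (k : Fin K) :
    DD z u v w (n+1) (Fin.snoc (α := fun _ => Fin K) y k)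
      = 1 / K * ((1 - u ^ 2) * w ^ 2 * v * z k * pLaw (par z u v w) n y
          + v * DD z u v w n y - 2 * (u * w * v) * DD z u v w n y * z k) := by
  rw [pLaw_eq z u v w hv, DD, DD, HH_snoc, HH_snoc]
  simp only [Fin.sum_univ_two, emit, transP]
  simp [par]
  ring

/-- one filter step: size bound -/
lemma filt_bound {R v B z m : ℝ} (hR : 0 ≤ R) (hR1 : R ≤ 1 / 128) (hv : 0 ≤ v) (hv1 : v ≤ 1 / 16)
    (hB : |B| ≤ 1 / 64) (hz : |z| ≤ 1) (hm : |m| ≤ 2 * R) :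
    |R * z + v * m - 2 * B * m * z| ≤ 3 / 2 * R ∧ 63 / 64 ≤ 1 + z * m ∧
    |(R * z + v * m - 2 * B * m * z) / (1 + z * m)| ≤ 2 * R := by
  have h1 : |R * z| ≤ R := by
    rw [abs_mul, abs_of_nonneg hR]; nlinarith
  have h2 : |v * m| ≤ 1 / 16 * (2 * R) := by
    rw [abs_mul, abs_of_nonneg hv]; gcongr
  have h3 : |2 * B * m * z| ≤ 2 * (1 / 64) * (2 * R) * 1 := by
    rw [abs_mul, abs_mul, abs_mul, abs_two]; gcongr
  have h4 : |z * m| ≤ 1 * (2 * R) := by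
    rw [abs_mul]; gcongr
  have hN : |R * z + v * m - 2 * B * m * z| ≤ 3 / 2 * R := by
    rw [abs_le] at *
    constructor <;> linarith [h1.1, h1.2, h2.1, h2.2, h3.1, h3.2]
  have hD : 63 / 64 ≤ 1 + z * m := by
    have := (abs_le.1 h4).1
    linarith
  refine ⟨hN, hD, ?_⟩
  rw [abs_div, abs_of_pos (show 0 < 1 + z * m by linarith), div_le_iff₀ (by linarith)]
  nlinarith

lemma filt_diff {R v v' B B' z m m' s : ℝ} (hR : 0 ≤ R) (hR1 : R ≤ 1 / 128)
    (hv : 0 ≤ v) (hv1 : v ≤ 1 / 16) (hv' : 0 ≤ v') (hv1' : v' ≤ 1 / 16)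
    (hB : |B| ≤ 1 / 64) (hB' : |B'| ≤ 1 / 64) (hz : |z| ≤ 1)
    (hm : |m| ≤ 2 * R) (hm' : |m'| ≤ 2 * R) (hs : |v - v'| ≤ s) (hBs : |B - B'| ≤ s)
    (hd : |m - m'| ≤ 16 * R * s) :
    |(R * z + v * m - 2 * B * m * z) / (1 + z * m)
      - (R * z + v' * m' - 2 * B' * m' * z) / (1 + z * m')| ≤ 16 * R * s := by
  obtain ⟨_, hD, hF⟩ := filt_bound hR hR1 hv hv1 hB hz hm
  obtain ⟨_, hD', hF'⟩ := filt_bound hR hR1 hv' hv1' hB' hz hm'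
  have hs0 : 0 ≤ s := (abs_nonneg _).trans hs
  set F' := (R * z + v' * m' - 2 * B' * m' * z) / (1 + z * m') with hF'def
  have hN' : R * z + v' * m' - 2 * B' * m' * z = F' * (1 + z * m') := by
    rw [hF'def]; field_simp
  have key : (R * z + v * m - 2 * B * m * z) / (1 + z * m) - F'
      = (v * (m - m') + (v - v') * m' - 2 * B * (m - m') * z - 2 * (B - B') * m' * z
          - F' * (m - m') * z) / (1 + z * m) := by
    rw [eq_div_iff (by linarith), sub_mul, div_mul_cancel₀ _ (by linarith)]
    linear_combination hN'
  have hRs : 0 ≤ R * s := mul_nonneg hR hs0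
  have a1 : |v * (m - m')| ≤ 1 / 16 * (16 * R * s) := by
    rw [abs_mul, abs_of_nonneg hv]; gcongr
  have a2 : |(v - v') * m'| ≤ s * (2 * R) := by
    rw [abs_mul]; gcongr
  have a3 : |2 * B * (m - m') * z| ≤ 2 * (1 / 64) * (16 * R * s) * 1 := by
    rw [abs_mul, abs_mul, abs_mul, abs_two]; gcongr
  have a4 : |2 * (B - B') * m' * z| ≤ 2 * s * (2 * R) * 1 := by
    rw [abs_mul, abs_mul, abs_mul, abs_two]; gcongr
  have a5 : |F' * (m - m') * z| ≤ (1 / 64) * (16 * R * s) * 1 := by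
    rw [abs_mul, abs_mul]; gcongr; linarith
  rw [key, abs_div, abs_of_pos (show 0 < 1 + z * m by linarith), div_le_iff₀ (by linarith)]
  have : |v * (m - m') + (v - v') * m' - 2 * B * (m - m') * z - 2 * (B - B') * m' * z
          - F' * (m - m') * z| ≤ 15 * R * s := by
    rw [abs_le] at a1 a2 a3 a4 a5 ⊢
    constructor <;> nlinarith
  nlinarith

/-- The filter. -/
noncomputable def mu {K : ℕ} (z : Fin K → ℝ) (u v w : ℝ) (n : ℕ) (y : Fin n → Fin K) : ℝ :=
  DD z u v w n y / pLaw (par z u v w) n y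

lemma mu_step {K : ℕ} (hK : 2 ≤ K) (z : Fin K → ℝ) (u v w : ℝ) (hv : v < 1) (n : ℕ)
    (y : Fin n → Fin K) (k : Fin K) (hP : 0 < pLaw (par z u v w) n y)
    (hD : 0 < 1 + z k * mu z u v w n y) :
    pLaw (par z u v w) (n+1) (Fin.snoc (α := fun _ => Fin K) y k)
      = 1 / K * (1 + z k * mu z u v w n y) * pLaw (par z u v w) n y ∧
    mu z u v w (n+1) (Fin.snoc (α := fun _ => Fin K) y k)
      = (((1 - u ^ 2) * w ^ 2 * v) * z k + v * mu z u v w n y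
          - 2 * (u * w * v) * mu z u v w n y * z k) / (1 + z k * mu z u v w n y) := by
  have hDD : DD z u v w n y = mu z u v w n y * pLaw (par z u v w) n y := by
    rw [mu]; field_simp
  have hK' : (0:ℝ) < K := by positivity
  have h1 : pLaw (par z u v w) (n+1) (Fin.snoc (α := fun _ => Fin K) y k)
      = 1 / K * (1 + z k * mu z u v w n y) * pLaw (par z u v w) n y := by
    rw [pLaw_step z u v w hv, hDD]; ring
  refine ⟨h1, ?_⟩
  rw [mu, h1, DD_step z u v w hv, hDD]
  generalize mu z u v w n y = m at *
  generalize pLaw (par z u v w) n y = P at *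
  rw [div_eq_div_iff (by positivity) (by positivity)]
  ring

lemma mu_bounds {K : ℕ} (hK : 2 ≤ K) (z : Fin K → ℝ) (hz : ∀ k, |z k| ≤ 1) (u v v' w w' R s : ℝ)
    (hR : R = (1 - u ^ 2) * w ^ 2 * v) (hR' : R = (1 - u ^ 2) * w' ^ 2 * v')
    (hR0 : 0 ≤ R) (hR1 : R ≤ 1 / 128)
    (hv : 0 ≤ v) (hv1 : v ≤ 1 / 16) (hv' : 0 ≤ v') (hv1' : v' ≤ 1 / 16)
    (hB : |u * w * v| ≤ 1 / 64) (hB' : |u * w' * v'| ≤ 1 / 64)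
    (hs : |v - v'| ≤ s) (hBs : |u * w * v - u * w' * v'| ≤ s) (n : ℕ) :
    ∀ y : Fin n → Fin K, 0 < pLaw (par z u v w) n y ∧ 0 < pLaw (par z u v' w') n y ∧
      |mu z u v w n y| ≤ 2 * R ∧ |mu z u v' w' n y| ≤ 2 * R ∧
      |mu z u v w n y - mu z u v' w' n y| ≤ 16 * R * s := by
  have hs0 : 0 ≤ s := (abs_nonneg _).trans hs
  have hK' : (0:ℝ) < K := by positivity
  induction n with
  | zero =>
    intro y
    rw [mu, mu, DD_zero _ _ _ _ (by linarith), DD_zero _ _ _ _ (by linarith), pLaw_zero, pLaw_zero]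
    have h16 : 0 ≤ 16 * R * s := by positivity
    simp only [zero_div, abs_zero, sub_zero]
    exact ⟨one_pos, one_pos, by linarith, by linarith, h16⟩
  | succ n ih =>
    intro y
    rw [← Fin.snoc_init_self y]
    generalize Fin.init y = x
    generalize y (Fin.last n) = k
    obtain ⟨hP, hP', hm, hm', hd⟩ := ih x
    obtain ⟨_, hD, hF⟩ := filt_bound hR0 hR1 hv hv1 hB (hz k) hm
    obtain ⟨_, hD', hF'⟩ := filt_bound hR0 hR1 hv' hv1' hB' (hz k) hm'
    obtain ⟨e1, e2⟩ := mu_step hK z u v w (by linarith) n x k hP (by linarith)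
    obtain ⟨e1', e2'⟩ := mu_step hK z u v' w' (by linarith) n x k hP' (by linarith)
    rw [← hR] at e2
    rw [← hR'] at e2'
    rw [e1, e2, e1', e2']
    refine ⟨?_, ?_, hF, hF', filt_diff hR0 hR1 hv hv1 hv' hv1' hB hB' (hz k) hm hm' hs hBs hd⟩
    · have : 0 < 1 + z k * mu z u v w n x := by linarith
      positivity
    · have : 0 < 1 + z k * mu z u v' w' n x := by linarith
      positivity

lemma chi_bound {K : ℕ} (hK : 2 ≤ K) (z : Fin K → ℝ) (hz : ∀ k, |z k| ≤ 1) (hz0 : ∑ k, z k = 0)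
    (P Q a b : ∀ n : ℕ, (Fin n → Fin K) → ℝ) (d : ℝ)
    (hP0 : ∀ y, P 0 y = 1) (hQ0 : ∀ y, Q 0 y = 1)
    (hP : ∀ n y, 0 < P n y)
    (hPs : ∀ n y k, P (n+1) (Fin.snoc (α := fun _ => Fin K) y k) = 1 / K * (1 + z k * a n y) * P n y)
    (hQs : ∀ n y k, Q (n+1) (Fin.snoc (α := fun _ => Fin K) y k) = 1 / K * (1 + z k * b n y) * Q n y)
    (ha : ∀ n y, |a n y| ≤ 1 / 2) (hab : ∀ n y, |a n y - b n y| ≤ d) (n : ℕ) :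
    ∑ y, P n y = 1 ∧ ∑ y, Q n y = 1 ∧ ∑ y, Q n y ^ 2 / P n y ≤ (1 + 2 * d ^ 2) ^ n := by
  have hK' : (0:ℝ) < K := by positivity
  have hlin : ∀ c : ℝ, ∑ k, 1 / (K:ℝ) * (1 + z k * c) = 1 := by
    intro c
    rw [← Finset.mul_sum, Finset.sum_add_distrib, ← Finset.sum_mul, hz0]
    simp
    field_simp
  induction n with
  | zero => simp [hP0, hQ0]
  | succ n ih =>
    obtain ⟨i1, i2, i3⟩ := ih
    refine ⟨?_, ?_, ?_⟩
    · rw [sum_snoc]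
      simp_rw [hPs, ← Finset.sum_mul, hlin, one_mul]
      exact i1
    · rw [sum_snoc]
      simp_rw [hQs, ← Finset.sum_mul, hlin, one_mul]
      exact i2
    · rw [sum_snoc, pow_succ]
      refine le_trans ?_ (mul_le_mul_of_nonneg_right i3 (by positivity))
      rw [Finset.sum_mul]
      refine Finset.sum_le_sum fun y _ => ?_
      have hd := hab n y
      have hPy := hP n y
      have hterm : ∀ k, Q (n+1) (Fin.snoc (α := fun _ => Fin K) y k) ^ 2
          / P (n+1) (Fin.snoc (α := fun _ => Fin K) y k)
          ≤ Q n y ^ 2 / P n y * (1 / (K:ℝ) * (1 + z k * (2 * b n y - a n y)) + 1 / K * (2 * d ^ 2)) := by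
        intro k
        have hza : |z k * a n y| ≤ 1 * (1 / 2) := by
          rw [abs_mul]; exact mul_le_mul (hz k) (ha n y) (abs_nonneg _) (by norm_num)
        have hD : 1 / 2 ≤ 1 + z k * a n y := by
          have := (abs_le.1 hza).1
          linarith
        have hzd : |z k * (a n y - b n y)| ≤ 1 * d := by
          rw [abs_mul]; exact mul_le_mul (hz k) hd (abs_nonneg _) (by norm_num)
        have hzd2 : (z k * (a n y - b n y)) ^ 2 ≤ d ^ 2 := by
          rw [← sq_abs]
          have := abs_nonneg (z k * (a n y - b n y))
          nlinarith
        have hmain : (1 + z k * b n y) ^ 2 / (1 + z k * a n y)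
            ≤ 1 + z k * (2 * b n y - a n y) + 2 * d ^ 2 := by
          rw [div_le_iff₀ (by linarith)]
          have : 0 ≤ (1 + z k * a n y - 1 / 2) * (2 * d ^ 2) :=
            mul_nonneg (by linarith) (by positivity)
          nlinarith
        have e : Q (n+1) (Fin.snoc (α := fun _ => Fin K) y k) ^ 2
          / P (n+1) (Fin.snoc (α := fun _ => Fin K) y k)
          = Q n y ^ 2 / P n y * (1 / (K:ℝ) * ((1 + z k * b n y) ^ 2 / (1 + z k * a n y))) := by
          rw [hPs, hQs]
          have : 1 + z k * a n y ≠ 0 := by linarith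
          field_simp
        rw [e]
        refine mul_le_mul_of_nonneg_left ?_ (by positivity)
        rw [← mul_add]
        exact mul_le_mul_of_nonneg_left hmain (by positivity)
      refine (Finset.sum_le_sum fun k _ => hterm k).trans (le_of_eq ?_)
      rw [← Finset.mul_sum, Finset.sum_add_distrib, hlin]
      simp
      left
      field_simp

open Classical in
lemma two_point {α : Type*} [Fintype α] (P Q : α → ℝ) (hP : ∀ y, 0 < P y) (hQ : ∀ y, 0 < Q y)
    (sP : ∑ y, P y = 1) (sQ : ∑ y, Q y = 1) (chi : ∑ y, Q y ^ 2 / P y ≤ 5 / 4)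
    (E F : α → Prop) (hEF : ∀ y, E y ∨ F y) :
    1 / 2 ≤ (∑ y, if E y then P y else 0) + (∑ y, if F y then Q y else 0) := by
  have h : ∀ y, Q y - (P y / 4 + (Q y ^ 2 / P y - 2 * Q y + P y))
      ≤ (if E y then P y else 0) + (if F y then Q y else 0) := by
    intro y
    have hPy := hP y
    have hQy := hQ y
    have e : Q y ^ 2 / P y - 2 * Q y + P y = (Q y - P y) ^ 2 / P y := by
      field_simp; ring
    have e1 : 0 ≤ (Q y - P y) ^ 2 / P y := by positivity
    have e2 : Q y - P y ≤ P y / 4 + (Q y - P y) ^ 2 / P y := by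
      rw [← sub_nonneg]
      have : P y / 4 + (Q y - P y) ^ 2 / P y - (Q y - P y) = (Q y - P y - P y / 2) ^ 2 / P y := by
        field_simp; ring
      rw [this]; positivity
    rw [e]
    rcases hEF y with hE | hF
    · rw [if_pos hE]
      split_ifs <;> linarith
    · rw [if_pos hF]
      split_ifs <;> linarith
  have := Finset.sum_le_sum fun y (_ : y ∈ Finset.univ) => h y
  simp only [Finset.sum_add_distrib, Finset.sum_sub_distrib, ← Finset.sum_div, ← Finset.mul_sum,
    sP, sQ] at this
  linarith

lemma unpack_pack {K : ℕ} (θ : Param K) (h : 0 < θ.p + θ.q)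
    (hf : 0 < enormF (fun k => θ.f0 k - θ.f1 k)) : unpack (pack θ) = θ := by
  obtain ⟨p, q, f0, f1⟩ := θ
  simp only [unpack, pack, phiOf, psiOf] at *
  generalize enormF (fun k => f0 k - f1 k) = e at *
  congr 1
  · field_simp; ring
  · field_simp; ring
  · funext k; field_simp; ring
  · funext k; field_simp; ring

lemma density_le_one {K : ℕ} {f : Fin K → ℝ} (h : IsDensity f) (k : Fin K) : f k ≤ 1 := by
  rw [← h.2]
  exact Finset.single_le_sum (fun i _ => h.1 i) (Finset.mem_univ k)

lemma pLaw_crude {K : ℕ} (θ : Param K) (hθ : Valid θ) (n : ℕ) (y : Fin n → Fin K) :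
    0 ≤ pLaw θ n y ∧ pLaw θ n y ≤ 2 ^ n := by
  obtain ⟨⟨hp0, hp1⟩, ⟨hq0, hq1⟩, h0, h1⟩ := hθ
  have hi : ∀ a, 0 ≤ initD θ a ∧ initD θ a ≤ 1 := by
    intro a
    unfold initD
    split_ifs
    · exact ⟨by positivity, by rw [div_le_one (by positivity)]; linarith⟩
    · exact ⟨by positivity, by rw [div_le_one (by positivity)]; linarith⟩
  have ht : ∀ a b, 0 ≤ transP θ a b ∧ transP θ a b ≤ 1 := by
    intro a b
    unfold transP
    split_ifs <;> constructor <;> linarith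
  have he : ∀ a k, 0 ≤ emit θ a k ∧ emit θ a k ≤ 1 := by
    intro a k
    unfold emit
    split_ifs
    · exact ⟨h0.1 k, density_le_one h0 k⟩
    · exact ⟨h1.1 k, density_le_one h1 k⟩
  have hA : ∀ (x : Fin n → Fin 2) (i : Fin n), 0 ≤ (if (i : ℕ) = 0 then initD θ (x i)
          else transP θ (x ⟨(i : ℕ) - 1, lt_of_le_of_lt (Nat.sub_le _ _) i.isLt⟩) (x i)) ∧
      (if (i : ℕ) = 0 then initD θ (x i)
          else transP θ (x ⟨(i : ℕ) - 1, lt_of_le_of_lt (Nat.sub_le _ _) i.isLt⟩) (x i)) ≤ 1 := by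
    intro x i
    split_ifs
    · exact hi _
    · exact ht _ _
  constructor
  · exact Finset.sum_nonneg fun x _ => mul_nonneg (Finset.prod_nonneg fun i _ => (hA x i).1)
      (Finset.prod_nonneg fun i _ => (he _ _).1)
  · refine (Finset.sum_le_card_nsmul _ _ 1 fun x _ => ?_).trans (by simp)
    exact mul_le_one₀ (Finset.prod_le_one (fun i _ => (hA x i).1) fun i _ => (hA x i).2)
      (Finset.prod_nonneg fun i _ => (he _ _).1)
      (Finset.prod_le_one (fun i _ => (he _ _).1) fun i _ => (he _ _).2)

open Classical in
lemma probOf_crude {K : ℕ} (θ : Param K) (hθ : Valid θ) (n : ℕ) (E : (Fin n → Fin K) → Prop) :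
    0 ≤ probOf θ n E ∧ probOf θ n E ≤ ∑ _y : Fin n → Fin K, (2:ℝ) ^ n := by
  constructor
  · refine Finset.sum_nonneg fun y _ => ?_
    split_ifs
    · exact (pLaw_crude θ hθ n y).1
    · exact le_rfl
  · refine Finset.sum_le_sum fun y _ => ?_
    split_ifs
    · exact (pLaw_crude θ hθ n y).2
    · positivity

lemma le_sup {K : ℕ} {L δ ε ζ : ℝ} (hδ : 0 < δ) (hζ : 0 < ζ) (n : ℕ)
    (E : PP K → (Fin n → Fin K) → Prop) (θ : Param K) (hθ : θ ∈ ThetaL K L δ ε ζ) :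
    probOf θ n (E (pack θ)) ≤ ⨆ π ∈ PhiL K L δ ε ζ, probOf (unpack π) n (E π) := by
  have hup : ∀ θ ∈ ThetaL K L δ ε ζ, unpack (pack θ) = θ := by
    rintro θ ⟨⟨hV, hp, hq, _, hf⟩, _⟩
    exact unpack_pack θ (by linarith) (by linarith)
  have hval : ∀ π ∈ PhiL K L δ ε ζ, Valid (unpack π) := by
    rintro π ⟨θ, hθ, rfl⟩
    rw [hup θ hθ]
    exact hθ.1.1
  have hmem : pack θ ∈ PhiL K L δ ε ζ := ⟨θ, hθ, rfl⟩
  have hb : BddAbove (Set.range fun π : PP K => ⨆ (_ : π ∈ PhiL K L δ ε ζ), probOf (unpack π) n (E π)) := by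
    refine ⟨∑ _y : Fin n → Fin K, (2:ℝ) ^ n, ?_⟩
    rintro _ ⟨π, rfl⟩
    refine Real.iSup_le (fun h => (probOf_crude _ (hval π h) n _).2) (by positivity)
  have h1 := le_ciSup hb (pack θ)
  refine le_trans (le_of_eq ?_) h1
  simp only [hmem, hup θ hθ]
  simp

/-- balanced sign vector -/
def zv (K : ℕ) (k : Fin K) : ℝ :=
  if (k : ℕ) < K / 2 then 1 else if (k : ℕ) < 2 * (K / 2) then -1 else 0

lemma zv_abs (K : ℕ) (k : Fin K) : |zv K k| ≤ 1 := by
  unfold zv; split_ifs <;> simp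

lemma zv_sums (K : ℕ) : ∑ k, zv K k = 0 ∧ ∑ k, zv K k ^ 2 = 2 * ((K / 2 : ℕ) : ℝ) := by
  have key : ∀ (a b : ℝ) , ∑ k : Fin K, (if (k : ℕ) < K / 2 then a else if (k : ℕ) < 2 * (K / 2) then b else 0)
      = (K / 2 : ℕ) * (a + b) := by
    intro a b
    rw [Fin.sum_univ_eq_sum_range (fun i : ℕ => if i < K / 2 then a else if i < 2 * (K / 2) then b else (0:ℝ))]
    obtain ⟨r, hr⟩ : ∃ r, K = K / 2 + (K / 2 + r) := ⟨K - 2 * (K / 2), by omega⟩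
    generalize K / 2 = h at *
    subst hr
    rw [Finset.sum_range_add, Finset.sum_range_add]
    have s1 : ∑ x ∈ Finset.range h, (if x < h then a else if x < 2 * h then b else (0:ℝ))
        = ∑ x ∈ Finset.range h, a := by
      refine Finset.sum_congr rfl fun x hx => ?_
      rw [Finset.mem_range] at hx
      rw [if_pos (by omega)]
    have s2 : ∑ x ∈ Finset.range h, (if h + x < h then a else if h + x < 2 * h then b else (0:ℝ))
        = ∑ x ∈ Finset.range h, b := by
      refine Finset.sum_congr rfl fun x hx => ?_
      rw [Finset.mem_range] at hx
      rw [if_neg (by omega), if_pos (by omega)]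
    have s3 : ∑ x ∈ Finset.range r, (if h + (h + x) < h then a else
        if h + (h + x) < 2 * h then b else (0:ℝ)) = ∑ x ∈ Finset.range r, (0:ℝ) := by
      refine Finset.sum_congr rfl fun x hx => ?_
      rw [if_neg (by omega), if_neg (by omega)]
    rw [s1, s2, s3]
    simp; ring
  constructor
  · simp only [zv, key]; ring
  · have : ∀ k : Fin K, zv K k ^ 2 = if (k : ℕ) < K / 2 then 1 else if (k : ℕ) < 2 * (K / 2) then 1 else 0 := by
      intro k; unfold zv; split_ifs <;> simp
    simp only [this, key]; ring

lemma par_mem {K : ℕ} (hK : 2 ≤ K) {L δ ε ζ v w : ℝ} (hL : L ≤ 1 / 3) (hδ : 0 < δ) (hδ1 : δ ≤ 1 / 6)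
    (hε : 0 < ε) (hv : ε ≤ v) (hv1 : v ≤ 1 / 16) (hζ : 0 < ζ)
    (hw : ζ * K / (2 * Real.sqrt (2 * ((K / 2 : ℕ) : ℝ))) ≤ w) (hw1 : w ≤ 1 / 4) :
    par (zv K) (1 - 4 * δ) v w ∈ ThetaL K L δ ε ζ := by
  have hK' : (0:ℝ) < K := by positivity
  have hh : (1:ℝ) ≤ ((K / 2 : ℕ) : ℝ) := by
    have : 1 ≤ K / 2 := by omega
    exact_mod_cast this
  set h : ℝ := ((K / 2 : ℕ) : ℝ) with hdef
  have hsq : 0 < Real.sqrt (2 * h) := Real.sqrt_pos.2 (by linarith)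
  have hw0 : 0 < w := lt_of_lt_of_le (by positivity) hw
  have dens : ∀ c : ℝ, |c| ≤ 2 → IsDensity (fun k => 1 / (K:ℝ) * (1 + c * w * zv K k)) := by
    intro c hc
    constructor
    · intro k
      have : |c * w * zv K k| ≤ 2 * (1 / 4) * 1 := by
        rw [abs_mul, abs_mul, abs_of_pos hw0]
        have := zv_abs K k
        gcongr
      have := (abs_le.1 this).1
      exact mul_nonneg (by positivity) (by linarith)
    · rw [← Finset.mul_sum, Finset.sum_add_distrib, ← Finset.mul_sum, (zv_sums K).1]
      simp
      field_simp
  have d0 := dens (1 - (1 - 4 * δ)) (by rw [abs_le]; constructor <;> linarith)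
  have d1 := dens (-(1 + (1 - 4 * δ))) (by rw [abs_le]; constructor <;> linarith)
  refine ⟨⟨⟨?_, ?_, d0, ?_⟩, ?_, ?_, ?_, ?_⟩, ?_⟩
  · constructor <;> simp only [par] <;> nlinarith
  · constructor <;> simp only [par] <;> nlinarith
  · convert d1 using 1
    funext k
    simp only [par]; ring
  · simp only [par]; nlinarith
  · simp only [par]; nlinarith
  · simp only [par]
    rw [abs_of_nonneg] <;> nlinarith
  · simp only [par, enormF]
    have : ∀ k, 1 / (K:ℝ) * (1 + (1 - (1 - 4 * δ)) * w * zv K k) - 1 / K * (1 - (1 + (1 - 4 * δ)) * w * zv K k)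
        = (2 * w / K) * zv K k := by intro k; ring
    simp only [this, mul_pow]
    rw [← Finset.mul_sum, (zv_sums K).2, Real.sqrt_mul (by positivity),
      Real.sqrt_sq (by positivity), ← hdef]
    rw [div_le_iff₀ (by positivity)] at hw
    rw [div_mul_eq_mul_div, le_div_iff₀ hK']
    linarith
  · simp only [par, Set.mem_ofPred_eq]
    rw [abs_of_nonneg] <;> nlinarith

lemma cover1 {t ε x : ℝ} (ht0 : 0 < t) (hε : 0 < ε) :
    (t * ε / 3) ^ 2 ≤ |x - ε| ^ 2 ∨ (t * ε / 3) ^ 2 ≤ |x - (1 + t) ^ 2 * ε| ^ 2 := by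
  by_contra! hc
  have h0 : 0 ≤ t * ε / 3 := by positivity
  have c1 := lt_of_pow_lt_pow_left₀ 2 h0 hc.1
  have c2 := lt_of_pow_lt_pow_left₀ 2 h0 hc.2
  rw [abs_lt] at c1 c2
  have h1 : (1 + t) ^ 2 * ε = ε + 2 * (t * ε) + t ^ 2 * ε := by ring
  have h2 : 0 < t ^ 2 * ε := by positivity
  have := mul_pos ht0 hε
  linarith [c1.1, c1.2, c2.1, c2.2]

lemma cover2 {t ε x : ℝ} (ht0 : 0 < t) (ht1 : t ≤ 1) (hε : 0 < ε) :
    (t / 3) ^ 2 ≤ |x / ε - 1| ^ 2 ∨ (t / 3) ^ 2 ≤ |x / ((1 + t) ^ 2 * ε) - 1| ^ 2 := by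
  by_contra! hc
  have h0 : 0 ≤ t / 3 := by positivity
  have c1 := lt_of_pow_lt_pow_left₀ 2 h0 hc.1
  have c2 := lt_of_pow_lt_pow_left₀ 2 h0 hc.2
  rw [abs_lt] at c1 c2
  have hv0 : 0 < (1 + t) ^ 2 * ε := by positivity
  have a1 : x < (1 + t / 3) * ε := by
    rw [← div_lt_iff₀ hε]; linarith [c1.2]
  have a2 : (1 - t / 3) * ((1 + t) ^ 2 * ε) < x := by
    rw [← lt_div_iff₀ hv0]; linarith [c2.1]
  have a3 : (1 - t / 3) * (1 + t) ^ 2 < 1 + t / 3 := by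
    have : (1 - t / 3) * (1 + t) ^ 2 * ε < (1 + t / 3) * ε := by linarith
    exact lt_of_mul_lt_mul_right this hε.le
  nlinarith [mul_pos ht0 ht0, mul_nonneg (mul_pos ht0 ht0).le (sub_nonneg.2 ht1)]

set_option maxHeartbeats 2000000 in
theorem statement15 (K : ℕ) (hK : 2 ≤ K) :
    ∃ c ε₀ : ℝ, 0 < c ∧ 0 < ε₀ ∧
      ∀ (L δ ε ζ : ℝ) (n : ℕ),
        0 < L → L ≤ 1 / 3 →
        δ ∈ Set.Ioo (0 : ℝ) 1 → δ ≤ 1 / 6 →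
        ε ∈ Set.Ioo (0 : ℝ) 1 → ε ≤ ε₀ →
        0 < ζ → ζ ≤ Real.sqrt (2 * ((K / 2 : ℕ) : ℝ)) / (4 * K) →
        1 ≤ n * δ ^ 2 * ε ^ 4 * ζ ^ 4 →
        (∀ est : (Fin n → Fin K) → ℝ,
          1 / 4 ≤ ⨆ π ∈ PhiL K L δ ε ζ,
            probOf (unpack π) n (fun y =>
              c / (n * δ ^ 2 * ε ^ 2 * ζ ^ 4) ≤ |est y - π.1.2.1| ^ 2))
        ∧ (∀ est : (Fin n → Fin K) → ℝ,
          1 / 4 ≤ ⨆ π ∈ PhiL K L δ ε ζ,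
            probOf (unpack π) n (fun y =>
              c / (n * δ ^ 2 * ε ^ 4 * ζ ^ 4) ≤ |est y / π.1.2.1 - 1| ^ 2)) := by
  have hK' : (2:ℝ) ≤ K := by exact_mod_cast hK
  set τ : ℝ := 1 / (2000 * (K:ℝ) ^ 2) with hτ
  have hτ0 : 0 < τ := by positivity
  have hτ1 : τ ≤ 1 := by
    rw [hτ, div_le_one (by positivity)]; nlinarith
  clear_value τ
  refine ⟨τ ^ 2 / 9, 1 / 64, by positivity, by norm_num, ?_⟩
  rintro L δ ε ζ n hL0 hL ⟨hδ, _⟩ hδ1 ⟨hε, _⟩ hε1 hζ hζ1 hn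
  have hn0 : (0:ℝ) < n := by
    rcases Nat.eq_zero_or_pos n with h | h
    · subst h; norm_num at hn
    · exact_mod_cast h
  set T : ℝ := Real.sqrt n * δ * ε ^ 2 * ζ ^ 2 with hT
  have hsn : 0 < Real.sqrt n := Real.sqrt_pos.2 hn0
  have hsn2 : Real.sqrt n ^ 2 = n := Real.sq_sqrt hn0.le
  have hT0 : 0 < T := by positivity
  have hT2 : T ^ 2 = n * δ ^ 2 * ε ^ 4 * ζ ^ 4 := by
    rw [hT]; linear_combination (δ ^ 2 * ε ^ 4 * ζ ^ 4) * hsn2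
  have hT1 : 1 ≤ T := by
    rw [← hT2] at hn
    nlinarith
  clear_value T
  set t : ℝ := τ / T with ht
  have ht0 : 0 < t := by positivity
  have htT : t * T = τ := by rw [ht]; field_simp
  have ht1 : t ≤ 1 := by
    rw [ht, div_le_one hT0]; linarith
  clear_value t
  set r : ℝ := Real.sqrt (2 * ((K / 2 : ℕ) : ℝ)) with hr
  have hr1 : 1 ≤ r := by
    rw [hr, Real.one_le_sqrt]
    have : 1 ≤ K / 2 := by omega
    have : (1:ℝ) ≤ ((K / 2 : ℕ) : ℝ) := by exact_mod_cast this
    linarith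
  clear_value r
  set ω : ℝ := ζ * K / (2 * r) with hω
  have hω0 : 0 < ω := by positivity
  have hω1 : ω ≤ 1 / 8 := by
    rw [le_div_iff₀ (by positivity)] at hζ1
    rw [hω, div_le_iff₀ (by positivity)]
    linarith
  have hω2 : ω ≤ ζ * K / 2 := by
    rw [hω]
    apply div_le_div_of_nonneg_left (by positivity) (by norm_num) (by linarith)
  clear_value ω
  have hv' : (1 + t) ^ 2 * ε ≤ 4 * ε := by
    have : (1 + t) ^ 2 ≤ 4 := by nlinarith
    exact mul_le_mul_of_nonneg_right this hε.le
  have hvv : ε ≤ (1 + t) ^ 2 * ε := by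
    have : 1 ≤ (1 + t) ^ 2 := by nlinarith
    exact le_mul_of_one_le_left hε.le this
  have m1 : par (zv K) (1 - 4 * δ) ε (ω * (1 + t)) ∈ ThetaL K L δ ε ζ :=
    par_mem hK hL hδ hδ1 hε le_rfl (by linarith) hζ (by rw [← hr, ← hω]; nlinarith) (by nlinarith)
  have m2 : par (zv K) (1 - 4 * δ) ((1 + t) ^ 2 * ε) ω ∈ ThetaL K L δ ε ζ :=
    par_mem hK hL hδ hδ1 hε hvv (by linarith) hζ (by rw [← hr, ← hω]) (by linarith)
  set R : ℝ := (1 - (1 - 4 * δ) ^ 2) * (ω * (1 + t)) ^ 2 * ε with hR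
  set s : ℝ := (1 + t) ^ 2 * ε - ε with hs
  clear_value R s
  have hg0 : 0 ≤ 1 - (1 - 4 * δ) ^ 2 := by nlinarith
  have hg1 : 1 - (1 - 4 * δ) ^ 2 ≤ 8 * δ := by nlinarith
  have hg2 : 1 - (1 - 4 * δ) ^ 2 ≤ 1 := by nlinarith
  have hR0 : 0 ≤ R := hR ▸ mul_nonneg (mul_nonneg hg0 (sq_nonneg _)) hε.le
  have hww : ω * (1 + t) ≤ 1 / 4 := by nlinarith
  have hww0 : 0 < ω * (1 + t) := by positivity
  have hR1 : R ≤ 1 / 128 := by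
    have : R ≤ 1 * (1 / 4) ^ 2 * (1 / 64) := by
      rw [hR]; gcongr
    linarith
  have hRb : R ≤ 8 * K ^ 2 * δ * ε * ζ ^ 2 := by
    have h1 : ω * (1 + t) ≤ ζ * K := by nlinarith
    have : R ≤ 8 * δ * (ζ * K) ^ 2 * ε := by
      rw [hR]; gcongr
    linarith
  have hs3 : s ≤ 3 * t * ε := by
    have : s = (2 * t + t ^ 2) * ε := by rw [hs]; ring
    rw [this]
    have : 2 * t + t ^ 2 ≤ 3 * t := by nlinarith
    nlinarith
  have hs2 : 2 * t * ε ≤ s := by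
    have : s = (2 * t + t ^ 2) * ε := by rw [hs]; ring
    rw [this]
    have : 0 ≤ t ^ 2 * ε := by positivity
    nlinarith
  have hs0 : 0 ≤ s := le_trans (by positivity) hs2
  have hu : |1 - 4 * δ| ≤ 1 := by rw [abs_le]; constructor <;> linarith
  have bounds := fun m => mu_bounds hK (zv K) (zv_abs K) (1 - 4 * δ) ε ((1 + t) ^ 2 * ε)
    (ω * (1 + t)) ω R s hR (by rw [hR]; ring) hR0 hR1 hε.le (by linarith) (by positivity)
    (by linarith)
    (by
      rw [abs_mul, abs_mul, abs_of_pos hε, abs_of_pos hww0]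
      calc |1 - 4 * δ| * (ω * (1 + t)) * ε ≤ 1 * (1 / 4) * (1 / 64) := by gcongr
        _ ≤ 1 / 64 := by norm_num)
    (by
      rw [abs_mul, abs_mul, abs_of_pos hω0, abs_of_pos (show 0 < (1 + t) ^ 2 * ε by positivity)]
      calc |1 - 4 * δ| * ω * ((1 + t) ^ 2 * ε) ≤ 1 * (1 / 8) * (1 / 16) := by
            gcongr; linarith
        _ ≤ 1 / 64 := by norm_num)
    (by rw [abs_sub_comm, ← hs, abs_of_nonneg hs0])
    (by
      have e : (1 - 4 * δ) * (ω * (1 + t)) * ε - (1 - 4 * δ) * ω * ((1 + t) ^ 2 * ε)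
        = -((1 - 4 * δ) * (ω * (1 + t)) * (t * ε)) := by ring
      rw [e, abs_neg, abs_mul, abs_mul, abs_of_pos hww0, abs_of_pos (show 0 < t * ε by positivity)]
      calc |1 - 4 * δ| * (ω * (1 + t)) * (t * ε) ≤ 1 * (1 / 4) * (t * ε) := by gcongr
        _ ≤ s := by nlinarith [mul_pos ht0 hε]) m
  have chi := chi_bound hK (zv K) (zv_abs K) (zv_sums K).1
    (pLaw (par (zv K) (1 - 4 * δ) ε (ω * (1 + t))))
    (pLaw (par (zv K) (1 - 4 * δ) ((1 + t) ^ 2 * ε) ω))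
    (mu (zv K) (1 - 4 * δ) ε (ω * (1 + t)))
    (mu (zv K) (1 - 4 * δ) ((1 + t) ^ 2 * ε) ω) (16 * R * s)
    (fun y => pLaw_zero _ y) (fun y => pLaw_zero _ y)
    (fun m y => (bounds m y).1)
    (fun m y k => (mu_step hK _ _ _ _ (by linarith) m y k (bounds m y).1 (by
      have h1 := (bounds m y).2.2.1
      have h2 := zv_abs K k
      have h3 : |zv K k * mu (zv K) (1 - 4 * δ) ε (ω * (1 + t)) m y| ≤ 1 * (2 * R) := by
        rw [abs_mul]; gcongr
      have := (abs_le.1 h3).1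
      linarith)).1)
    (fun m y k => (mu_step hK _ _ _ _ (by linarith) m y k (bounds m y).2.1 (by
      have h1 := (bounds m y).2.2.2.1
      have h2 := zv_abs K k
      have h3 : |zv K k * mu (zv K) (1 - 4 * δ) ((1 + t) ^ 2 * ε) ω m y| ≤ 1 * (2 * R) := by
        rw [abs_mul]; gcongr
      have := (abs_le.1 h3).1
      linarith)).1)
    (fun m y => (bounds m y).2.2.1.trans (by linarith))
    (fun m y => (bounds m y).2.2.2.2) n
  obtain ⟨sP, sQ, hchi⟩ := chi
  have hd : 16 * R * s * Real.sqrt n ≤ 1 / 5 := by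
    have h1 : 16 * R * s ≤ 16 * (8 * K ^ 2 * δ * ε * ζ ^ 2) * (3 * t * ε) := by gcongr
    have h2 : 16 * R * s * Real.sqrt n
        ≤ 16 * (8 * K ^ 2 * δ * ε * ζ ^ 2) * (3 * t * ε) * Real.sqrt n := by gcongr
    have h3 : 16 * (8 * K ^ 2 * δ * ε * ζ ^ 2) * (3 * t * ε) * Real.sqrt n
        = 384 * K ^ 2 * (t * T) := by rw [hT]; ring
    rw [h3, htT, hτ] at h2
    refine h2.trans ?_
    have : 384 * (K:ℝ) ^ 2 * (1 / (2000 * (K:ℝ) ^ 2)) = 384 / 2000 := by field_simp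
    rw [this]; norm_num
  have hd0 : 0 ≤ 16 * R * s * Real.sqrt n := by positivity
  have hd2 : (n:ℝ) * (2 * (16 * R * s) ^ 2) ≤ 1 / 5 := by
    have : (n:ℝ) * (2 * (16 * R * s) ^ 2) = 2 * (16 * R * s * Real.sqrt n) ^ 2 := by
      rw [mul_pow _ (Real.sqrt n), hsn2]; ring
    rw [this]; nlinarith
  have hchi' : ∑ y, pLaw (par (zv K) (1 - 4 * δ) ((1 + t) ^ 2 * ε) ω) n y ^ 2
      / pLaw (par (zv K) (1 - 4 * δ) ε (ω * (1 + t))) n y ≤ 5 / 4 := by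
    refine hchi.trans ?_
    have h1 : (1 + 2 * (16 * R * s) ^ 2) ^ n ≤ Real.exp (2 * (16 * R * s) ^ 2) ^ n := by
      gcongr
      linarith [Real.add_one_le_exp (2 * (16 * R * s) ^ 2)]
    rw [← Real.exp_nat_mul] at h1
    have h2 : Real.exp ((n:ℝ) * (2 * (16 * R * s) ^ 2)) ≤ Real.exp (1 / 5) := Real.exp_le_exp.2 hd2
    have h3 : Real.exp (1 / 5) * Real.exp (-(1 / 5)) = 1 := by rw [← Real.exp_add]; simp
    have h4 := Real.add_one_le_exp (-(1 / 5 : ℝ))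
    have h5 := Real.exp_pos (1 / 5)
    nlinarith
  have fin : ∀ E : PP K → (Fin n → Fin K) → Prop,
      (∀ y, E (pack (par (zv K) (1 - 4 * δ) ε (ω * (1 + t)))) y ∨
        E (pack (par (zv K) (1 - 4 * δ) ((1 + t) ^ 2 * ε) ω)) y) →
      1 / 4 ≤ ⨆ π ∈ PhiL K L δ ε ζ, probOf (unpack π) n (E π) := by
    intro E hE
    have h1 := le_sup hδ hζ n E _ m1
    have h2 := le_sup hδ hζ n E _ m2
    have h3 := two_point _ _ (fun y => (bounds n y).1) (fun y => (bounds n y).2.1) sP sQ hchi' _ _ hE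
    unfold probOf at h1 h2
    unfold probOf
    linarith
  have p1 : (pack (par (zv K) (1 - 4 * δ) ε (ω * (1 + t)))).1.2.1 = ε := by
    simp only [pack, phiOf, par]; ring
  have p2 : (pack (par (zv K) (1 - 4 * δ) ((1 + t) ^ 2 * ε) ω)).1.2.1 = (1 + t) ^ 2 * ε := by
    simp only [pack, phiOf, par]; ring
  have ht2 : t ^ 2 = τ ^ 2 / (n * δ ^ 2 * ε ^ 4 * ζ ^ 4) := by
    rw [ht, div_pow, hT2]
  constructor
  · intro est
    refine fin (fun π y => _ ≤ |est y - π.1.2.1| ^ 2) fun y => ?_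
    rw [p1, p2]
    have e : τ ^ 2 / 9 / (n * δ ^ 2 * ε ^ 2 * ζ ^ 4) = (t * ε / 3) ^ 2 := by
      rw [div_pow (t * ε) 3, mul_pow t ε, ht2]; field_simp; norm_num
    rw [e]
    exact cover1 ht0 hε
  · intro est
    refine fin (fun π y => _ ≤ |est y / π.1.2.1 - 1| ^ 2) fun y => ?_
    rw [p1, p2]
    have e : τ ^ 2 / 9 / (n * δ ^ 2 * ε ^ 4 * ζ ^ 4) = (t / 3) ^ 2 := by
      rw [div_pow t 3, ht2]; field_simp; norm_num
    rw [e]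
    exact cover2 ht0 ht1 hε

end PaperHMM
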